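/- A normalized non-degenerate monoid surface of degree d has at most d(d−1)/2 singular points other than the (d−1)-uple point O; moreover, if this maximum number is attained, then every singularity other than O is an ordinary node (type A₁). -/

import Mathlib

open MvPolynomial

variable {K : Type*} [Field K]

def SingularAt {R : Type*} [CommRing R] {n : ℕ} (F : MvPolynomial (Fin (n + 1)) R)
    (P : Fin (n + 1) → R) : Prop :=
  eval P F = 0 ∧ ∀ i, eval P (pderiv i F) = 0

noncomputable def localEq (F : MvPolynomial (Fin 4) K) (P : Fin 4 → K) (r : Fin 4) :
    MvPolynomial (Fin 3) K :=
  aeval (r.succAboveCases (1 : MvPolynomial (Fin 3) K)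
    (fun j => C (P (r.succAbove j) / P r) + X j)) F

/-- `g` defines an `A_n` singularity at the origin. -/
def IsATypeSing (g : MvPolynomial (Fin 3) K) (n : ℕ) : Prop :=
  ∃ e : MvPowerSeries (Fin 3) K ≃ₐ[K] MvPowerSeries (Fin 3) K,
    e (g : MvPowerSeries (Fin 3) K) =
      (MvPowerSeries.X 0) ^ 2 + (MvPowerSeries.X 1) ^ 2 + (MvPowerSeries.X 2) ^ (n + 1)

theorem hom_finrank (n : ℕ) :
    Module.finrank K (homogeneousSubmodule (Fin 3) K n) = (n + 2).choose 2 := by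
  classical
  have e : homogeneousSubmodule (Fin 3) K n = AddMonoidAlgebra.supported _ K {d | d.degree = n} :=
    homogeneousSubmodule_eq_finsupp_supported _ _ _
  have hset : ({d : Fin 3 →₀ ℕ | d.degree = n}) = ((Finset.univ : Finset (Fin 3)).finsuppAntidiag n : Finset (Fin 3 →₀ ℕ)) := by
    ext d
    simp [Finset.mem_finsuppAntidiag, Finsupp.degree_eq_sum]
  have hb := (AddMonoidAlgebra.supportedEquivFinsupp (S := K) (R := K)
    {d : Fin 3 →₀ ℕ | d.degree = n}).finrank_eq
  rw [e, hb, hset]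
  simp only [Module.finrank_finsupp_self, Finset.coe_sort_coe, Fintype.card_coe]
  rw [Finset.card_finsuppAntidiag_nat_eq_choose]
  simp only [Finset.card_univ, Fintype.card_fin]
  rw [show 3 + n - 1 = n + 2 by omega, Nat.choose_symm_add]

theorem eval_smul_hom {σ : Type*} {f : MvPolynomial σ K} {n : ℕ} (hf : f.IsHomogeneous n)
    (c : K) (b : σ → K) : eval (c • b) f = c ^ n * eval b f := by
  rw [eval_eq, eval_eq, Finset.mul_sum]
  refine Finset.sum_congr rfl fun d hd => ?_
  have := hf.degree_eq_sum_deg_support hd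
  simp only [Pi.smul_apply, smul_eq_mul, mul_pow, Finset.prod_mul_distrib, Finset.prod_pow_eq_pow_sum]
  rw [this]; ring

theorem bezout_count {m n N : ℕ} {f g : MvPolynomial (Fin 3) K}
    (hf : f.IsHomogeneous m) (hg : g.IsHomogeneous n) (hf0 : f ≠ 0)
    (hgcd : ∀ q : MvPolynomial (Fin 3) K, q ∣ f → q ∣ g → IsUnit q)
    {ι : Type*} [Fintype ι] (h : ι → MvPolynomial (Fin 3) K) (hN : m + n ≤ N)
    (hh : ∀ i, (h i).IsHomogeneous N)
    (hli : ∀ (a b : MvPolynomial (Fin 3) K) (c : ι → K), a * f + b * g + ∑ i, c i • h i = 0 → c = 0) :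
    Fintype.card ι ≤ m * n := by
  classical
  let S := homogeneousSubmodule (Fin 3) K
  have hfd : ∀ k, Module.Finite K (S k) := fun k =>
    Module.Finite.iff_fg.mpr (homogeneousSubmodule_fg (Fin 3) K k)
  let Ψ : (S (N - m) × S (N - n)) × (ι → K) →ₗ[K] MvPolynomial (Fin 3) K :=
    LinearMap.coprod (LinearMap.coprod ((LinearMap.mulRight K f).comp (S (N - m)).subtype)
      ((LinearMap.mulRight K g).comp (S (N - n)).subtype)) (Fintype.linearCombination K h)
  have hΨ : ∀ a b c, Ψ ((a, b), c) = a * f + b * g + ∑ i, c i • h i := by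
    intro a b c
    simp [Ψ, Fintype.linearCombination_apply]
  let Θ : S (N - m - n) →ₗ[K] (S (N - m) × S (N - n)) × (ι → K) :=
    LinearMap.prod (LinearMap.prod
      ((LinearMap.mulRight K (-g)).restrict (p := S (N - m - n)) (q := S (N - m)) (by
        intro x hx
        have : (x * -g).IsHomogeneous (N - m - n + n) := IsHomogeneous.mul hx hg.neg
        rwa [show N - m - n + n = N - m by omega] at this))
      ((LinearMap.mulRight K f).restrict (p := S (N - m - n)) (q := S (N - n)) (by
        intro x hx
        have : (x * f).IsHomogeneous (N - m - n + m) := IsHomogeneous.mul hx hf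
        rwa [show N - m - n + m = N - n by omega] at this))) 0
  have hker : LinearMap.ker Ψ ≤ LinearMap.range Θ := by
    rintro ⟨⟨⟨a, ha⟩, ⟨b, hb⟩⟩, c⟩ hx
    rw [LinearMap.mem_ker, hΨ] at hx
    have hc := hli a b c hx
    subst hc
    simp at hx
    have hdvd : f ∣ b := by
      have h1 : f ∣ b * g := by
        refine ⟨-a, ?_⟩
        linear_combination hx
      have : IsRelPrime f g := fun q h1 h2 => hgcd q h1 h2
      exact this.dvd_of_dvd_mul_right h1
    obtain ⟨q, hq⟩ := hdvd
    letI : GradedAlgebra (homogeneousSubmodule (Fin 3) K) := MvPolynomial.gradedAlgebra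
    let q' : MvPolynomial (Fin 3) K :=
      DirectSum.decompose (homogeneousSubmodule (Fin 3) K) q (N - m - n)
    have hq' : b = f * q' := by
      have h1 := DirectSum.coe_decompose_mul_add_of_left_mem
        (homogeneousSubmodule (Fin 3) K) (i := m) (j := N - m - n) (a := f) (b := q) hf
      rw [← hq, show m + (N - m - n) = N - n by omega,
        DirectSum.decompose_of_mem_same (homogeneousSubmodule (Fin 3) K) hb] at h1
      exact h1
    refine ⟨⟨q', (DirectSum.decompose (homogeneousSubmodule (Fin 3) K) q (N - m - n)).2⟩, ?_⟩
    refine Prod.ext (Prod.ext (Subtype.ext ?_) (Subtype.ext ?_)) rfl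
    · change q' * -g = a
      refine mul_right_cancel₀ hf0 ?_
      rw [hq'] at hx
      linear_combination -hx
    · change q' * f = b
      rw [hq', mul_comm]
  have hrange : LinearMap.range Ψ ≤ S N := by
    rintro _ ⟨⟨⟨⟨a, ha⟩, ⟨b, hb⟩⟩, c⟩, rfl⟩
    rw [hΨ]
    refine Submodule.add_mem _ (Submodule.add_mem _ ?_ ?_) (Submodule.sum_mem _ fun i _ => Submodule.smul_mem _ _ (hh i))
    · have : (a * f).IsHomogeneous (N - m + m) := IsHomogeneous.mul ha hf
      rwa [show N - m + m = N by omega] at this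
    · have : (b * g).IsHomogeneous (N - n + n) := IsHomogeneous.mul hb hg
      rwa [show N - n + n = N by omega] at this
  have h1 := LinearMap.finrank_range_add_finrank_ker Ψ
  have h2 := Submodule.finrank_mono hker
  have h3 := LinearMap.finrank_range_le Θ
  have h4 := Submodule.finrank_mono hrange
  rw [Module.finrank_prod, Module.finrank_prod, Module.finrank_pi] at h1
  simp only [S, hom_finrank] at h1 h2 h3 h4
  obtain ⟨k, rfl⟩ := Nat.exists_eq_add_of_le hN
  have e1 : m + n + k - m + 2 = n + k + 2 := by omega
  have e2 : m + n + k - n + 2 = m + k + 2 := by omega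
  have e3 : m + n + k - m - n + 2 = k + 2 := by omega
  rw [e1, e2] at h1
  rw [e3] at h3
  have hch : ∀ j : ℕ, (((j+2).choose 2 : ℕ) : ℚ) = (j+2)*(j+1)/2 := by
    intro j
    rw [Nat.cast_choose_two]; push_cast; ring
  have h5 : (n + k + 2).choose 2 + (m + k + 2).choose 2 + Fintype.card ι ≤ (m + n + k + 2).choose 2 + (k + 2).choose 2 := by
    omega
  have h6 : ((n + k + 2).choose 2 + (m + k + 2).choose 2 + Fintype.card ι : ℚ) ≤ (m + n + k + 2).choose 2 + (k + 2).choose 2 := by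
    exact_mod_cast h5
  rw [hch, hch, hch, hch] at h6
  push_cast at h6
  have : (Fintype.card ι : ℚ) ≤ m * n := by linarith
  exact_mod_cast this

/-- a 2-jet of a curve -/
noncomputable def jet (b v w : Fin 3 → K) : Fin 3 → Polynomial K :=
  fun l => Polynomial.C (b l) + Polynomial.C (v l) * Polynomial.X
    + Polynomial.C (w l) * Polynomial.X ^ 2

/-- the linear form with coefficient vector `a` -/
noncomputable def linForm (a : Fin 3 → K) : MvPolynomial (Fin 3) K := ∑ l, C (a l) * X l

theorem linForm_hom (a : Fin 3 → K) : (linForm a).IsHomogeneous 1 :=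
  IsHomogeneous.sum _ _ _ fun l _ => isHomogeneous_C_mul_X _ _

theorem aeval_jet_linForm (b v w a : Fin 3 → K) :
    aeval (jet b v w) (linForm a) = Polynomial.C (a ⬝ᵥ b) +
      Polynomial.X * (Polynomial.C (a ⬝ᵥ v) + Polynomial.C (a ⬝ᵥ w) * Polynomial.X) := by
  simp only [linForm, jet, map_sum, map_mul, aeval_X, algHom_C, dotProduct, Fin.sum_univ_three,
    map_add, Polynomial.algebraMap_eq]
  ring

theorem exists_form {x y : Fin 3 → K} (h : ∀ c : K, x ≠ c • y) :
    ∃ a : Fin 3 → K, a ⬝ᵥ y = 0 ∧ a ⬝ᵥ x ≠ 0 := by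
  have hx : x ∉ Submodule.span K {y} := by
    rw [Submodule.mem_span_singleton]
    rintro ⟨c, hc⟩
    exact h c hc.symm
  obtain ⟨φ, h1, h2⟩ := Submodule.exists_le_ker_of_notMem hx
  have hφ : ∀ z, (fun l => φ (Pi.single l 1)) ⬝ᵥ z = φ z := by
    intro z
    rw [LinearMap.pi_apply_eq_sum_univ φ z]
    refine Finset.sum_congr rfl fun l _ => ?_
    have hs : (Pi.single l 1 : Fin 3 → K) = fun j => if l = j then 1 else 0 := by
      ext j
      simp [Pi.single_apply, eq_comm]
    rw [smul_eq_mul, mul_comm, ← hs]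
  refine ⟨fun l => φ (Pi.single l 1), ?_, ?_⟩
  · rw [hφ]
    exact h2 (Submodule.mem_span_singleton_self y)
  · rw [hφ]; exact h1

theorem bezout_jets {m n : ℕ} {f g : MvPolynomial (Fin 3) K}
    (hf : f.IsHomogeneous m) (hg : g.IsHomogeneous n) (hf0 : f ≠ 0)
    (hgcd : ∀ q : MvPolynomial (Fin 3) K, q ∣ f → q ∣ g → IsUnit q)
    {ι : Type*} [Fintype ι] (b v w : ι → Fin 3 → K) (k : ι → ℕ)
    (hb : ∀ i, b i ≠ 0) (hv : ∀ i, ∀ c : K, v i ≠ c • b i)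
    (hbb : ∀ i j, i ≠ j → ∀ c : K, b i ≠ c • b j)
    (hfk : ∀ i, Polynomial.X ^ k i ∣ aeval (jet (b i) (v i) (w i)) f)
    (hgk : ∀ i, Polynomial.X ^ k i ∣ aeval (jet (b i) (v i) (w i)) g) :
    ∑ i, k i ≤ m * n := by
  classical
  have hm : ∀ i, ∃ a : Fin 3 → K, a ⬝ᵥ b i ≠ 0 := fun i => by
    obtain ⟨a, -, h⟩ := exists_form (x := b i) (y := 0) (by simpa using hb i)
    exact ⟨a, h⟩
  choose mm hmm using hm
  choose u hu0 hu1 using fun i => exists_form (hv i)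
  have hl : ∀ i j, ∃ a : Fin 3 → K, i ≠ j → a ⬝ᵥ b j = 0 ∧ a ⬝ᵥ b i ≠ 0 := fun i j => by
    by_cases h : i = j
    · exact ⟨0, fun h' => absurd h h'⟩
    · obtain ⟨a, ha⟩ := exists_form (hbb i j h)
      exact ⟨a, fun _ => ha⟩
  choose l hl using hl
  set E := ∑ i, k i with hE
  have hkE : ∀ i, k i ≤ E := fun i => Finset.single_le_sum (fun _ _ => Nat.zero_le _) (Finset.mem_univ i)
  let r : (Σ i, Fin (k i)) → ℕ := fun p => (Finset.univ.erase p.1).card * E + p.2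
  let N := m + n + (Fintype.card ι) * E + E
  have hr : ∀ p, r p ≤ N := by
    rintro ⟨i, t⟩
    have h1 : (Finset.univ.erase i).card * E ≤ Fintype.card ι * E :=
      Nat.mul_le_mul_right _ (Finset.card_le_univ _)
    have h2 := hkE i
    have h3 := t.2
    simp only [r, N]
    omega
  let h : (Σ i, Fin (k i)) → MvPolynomial (Fin 3) K := fun p =>
    (∏ j ∈ Finset.univ.erase p.1, linForm (l p.1 j) ^ E) * linForm (u p.1) ^ (p.2 : ℕ) *
      linForm (mm p.1) ^ (N - r p)
  have hh : ∀ p, (h p).IsHomogeneous N := by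
    intro p
    have h1 : (∏ j ∈ Finset.univ.erase p.1, linForm (l p.1 j) ^ E).IsHomogeneous
        (∑ j ∈ Finset.univ.erase p.1, E) :=
      IsHomogeneous.prod _ _ _ fun j _ => by
        have := (linForm_hom (l p.1 j)).pow E
        rwa [one_mul] at this
    have h2 := (linForm_hom (u p.1)).pow (p.2 : ℕ)
    have h3 := (linForm_hom (mm p.1)).pow (N - r p)
    have h4 := (h1.mul h2).mul h3
    have h5 : ∑ j ∈ Finset.univ.erase p.1, E + 1 * (p.2 : ℕ) + 1 * (N - r p) = N := by
      have := hr p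
      rw [Finset.sum_const, smul_eq_mul, one_mul, one_mul]
      change r p + (N - r p) = N
      omega
    rw [h5] at h4
    exact h4
  have key := bezout_count (N := N) hf hg hf0 hgcd h (by simp only [N]; omega) hh ?_
  · simpa using key
  intro A B c hc
  -- facts about the test polynomials
  have F1 : ∀ i (p : Σ i, Fin (k i)), p.1 ≠ i →
      Polynomial.X ^ E ∣ aeval (jet (b i) (v i) (w i)) (h p) := by
    intro i p hp
    have h1 : linForm (l p.1 i) ^ E ∣ h p := by
      refine Dvd.dvd.mul_right (Dvd.dvd.mul_right ?_ _) _
      exact Finset.dvd_prod_of_mem (fun j => linForm (l p.1 j) ^ E) (by simp [hp.symm])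
    refine dvd_trans ?_ (map_dvd (aeval (jet (b i) (v i) (w i))) h1)
    rw [map_pow, aeval_jet_linForm, (hl p.1 i hp).1]
    exact pow_dvd_pow_of_dvd (by simp) _
  have F2 : ∀ i (t : Fin (k i)), ∃ U : Polynomial K, U.coeff 0 ≠ 0 ∧
      aeval (jet (b i) (v i) (w i)) (h ⟨i, t⟩) = Polynomial.X ^ (t : ℕ) * U := by
    intro i t
    refine ⟨aeval (jet (b i) (v i) (w i)) (∏ j ∈ Finset.univ.erase i, linForm (l i j) ^ E) *
      (Polynomial.C (u i ⬝ᵥ v i) + Polynomial.C (u i ⬝ᵥ w i) * Polynomial.X) ^ (t : ℕ) *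
      aeval (jet (b i) (v i) (w i)) (linForm (mm i) ^ (N - r ⟨i, t⟩)), ?_, ?_⟩
    · simp only [Polynomial.coeff_zero_eq_eval_zero, Polynomial.eval_mul, map_prod, map_pow,
        Polynomial.eval_prod, Polynomial.eval_pow, aeval_jet_linForm]
      simp only [Polynomial.eval_add, Polynomial.eval_mul, Polynomial.eval_X, Polynomial.eval_C,
        zero_mul, mul_zero, add_zero]
      refine mul_ne_zero (mul_ne_zero ?_ ?_) ?_
      · rw [Finset.prod_ne_zero_iff]
        intro j hj
        have hj' : i ≠ j := by simpa [eq_comm] using hj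
        exact pow_ne_zero _ (hl i j hj').2
      · exact pow_ne_zero _ (hu1 i)
      · exact pow_ne_zero _ (hmm i)
    · simp only [h, map_mul]
      rw [map_pow _ (linForm (u i)), aeval_jet_linForm, hu0]
      simp only [map_zero, zero_add, mul_pow]
      ring
  have F3 : ∀ i, ∀ t : ℕ, ∀ ht : t < k i, c ⟨i, ⟨t, ht⟩⟩ = 0 := by
    intro i t
    induction t using Nat.strong_induction_on with
    | _ t ih =>
    intro ht
    have h1 : Polynomial.X ^ k i ∣ aeval (jet (b i) (v i) (w i)) (∑ p, c p • h p) := by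
      have : (∑ p, c p • h p) = -(A * f + B * g) := by linear_combination hc
      rw [this, map_neg, dvd_neg, map_add, map_mul, map_mul]
      exact dvd_add (Dvd.dvd.mul_left (hfk i) _) (Dvd.dvd.mul_left (hgk i) _)
    rw [Polynomial.X_pow_dvd_iff] at h1
    have h2 := h1 t ht
    rw [map_sum, Polynomial.finsetSum_coeff,
      Finset.sum_eq_single (⟨i, ⟨t, ht⟩⟩ : Σ i, Fin (k i))] at h2
    · obtain ⟨U, hU, hU'⟩ := F2 i ⟨t, ht⟩
      rw [map_smul, hU', Polynomial.coeff_smul] at h2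
      simp only [Polynomial.coeff_X_pow_mul', le_refl, if_true, Nat.sub_self, smul_eq_mul] at h2
      exact (mul_eq_zero.mp h2).resolve_right hU
    · rintro ⟨j, s⟩ - hne
      by_cases hji : j = i
      · subst hji
        obtain ⟨U, hU, hU'⟩ := F2 j s
        rw [map_smul, hU', Polynomial.coeff_smul]
        rcases lt_trichotomy (s : ℕ) t with hst | hst | hst
        · have := ih s hst s.2
          simp only [Fin.eta] at this
          rw [this, zero_smul]
        · exact absurd (by subst hst; rfl) hne
        · rw [Polynomial.coeff_X_pow_mul', if_neg (by omega), smul_zero]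
      · have := F1 i ⟨j, s⟩ hji
        rw [Polynomial.X_pow_dvd_iff] at this
        rw [map_smul, Polynomial.coeff_smul, this t (lt_of_lt_of_le ht (hkE i)), smul_zero]
    · intro h; exact absurd (Finset.mem_univ _) h
  funext ⟨i, t⟩
  exact F3 i t t.2

theorem maxI_iff (p : MvPowerSeries (Fin 3) K) :
    p ∈ (Ideal.span (Set.range MvPowerSeries.X) : Ideal (MvPowerSeries (Fin 3) K)) ↔
      MvPowerSeries.constantCoeff p = 0 := by
  constructor
  · intro hp
    have : (Ideal.span (Set.range MvPowerSeries.X) : Ideal (MvPowerSeries (Fin 3) K)) ≤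
        RingHom.ker (MvPowerSeries.constantCoeff (σ := Fin 3) (R := K)) := by
      rw [Ideal.span_le]
      rintro _ ⟨i, rfl⟩
      simp
    exact this hp
  · intro hp
    let q0 : MvPowerSeries (Fin 3) K := fun d => if d 0 ≠ 0 then MvPowerSeries.coeff d p else 0
    let q1 : MvPowerSeries (Fin 3) K := fun d =>
      if d 0 = 0 ∧ d 1 ≠ 0 then MvPowerSeries.coeff d p else 0
    let q2 : MvPowerSeries (Fin 3) K := fun d =>
      if d 0 = 0 ∧ d 1 = 0 ∧ d 2 ≠ 0 then MvPowerSeries.coeff d p else 0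
    have h0 : ∀ d, MvPowerSeries.coeff d q0 = if d 0 ≠ 0 then MvPowerSeries.coeff d p else 0 :=
      fun d => rfl
    have h1 : ∀ d, MvPowerSeries.coeff d q1 =
      if d 0 = 0 ∧ d 1 ≠ 0 then MvPowerSeries.coeff d p else 0 := fun d => rfl
    have h2 : ∀ d, MvPowerSeries.coeff d q2 =
      if d 0 = 0 ∧ d 1 = 0 ∧ d 2 ≠ 0 then MvPowerSeries.coeff d p else 0 := fun d => rfl
    have e : p = q0 + q1 + q2 := by
      ext d
      rw [map_add, map_add, h0, h1, h2]
      by_cases a0 : d 0 = 0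
      · by_cases a1 : d 1 = 0
        · by_cases a2 : d 2 = 0
          · have : d = 0 := by
              ext i; fin_cases i <;> assumption
            subst this
            simpa using hp
          · simp [a0, a1, a2]
        · simp [a0, a1]
      · simp [a0]
    have hX : ∀ i (q : MvPowerSeries (Fin 3) K), MvPowerSeries.X i ∣ q →
        q ∈ (Ideal.span (Set.range MvPowerSeries.X) : Ideal (MvPowerSeries (Fin 3) K)) :=
      fun i q hq => Ideal.mem_of_dvd _ hq (Ideal.subset_span ⟨i, rfl⟩)
    rw [e]
    refine Ideal.add_mem _ (Ideal.add_mem _ (hX 0 _ ?_) (hX 1 _ ?_)) (hX 2 _ ?_)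
    · rw [MvPowerSeries.X_dvd_iff]
      intro d hd
      rw [h0]; simp [hd]
    · rw [MvPowerSeries.X_dvd_iff]
      intro d hd
      rw [h1]; simp [hd]
    · rw [MvPowerSeries.X_dvd_iff]
      intro d hd
      rw [h2]; simp [hd]

theorem bij_of_unip {R : Type*} [CommRing R] (I : Ideal R) [IsAdicComplete I R] (φ : R →+* R)
    (h : ∀ n, ∀ p ∈ I ^ n, φ p - p ∈ I ^ (n + 1)) : Function.Bijective φ := by
  constructor
  · rw [injective_iff_map_eq_zero]
    intro p hp
    have : ∀ n, p ∈ I ^ n := by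
      intro n
      induction n with
      | zero => simp
      | succ n ih =>
        have := h n p ih
        rw [hp, zero_sub] at this
        exact (Ideal.neg_mem_iff _).mp this
    refine IsHausdorff.haus (I := I) inferInstance p fun n => ?_
    rw [SModEq.zero]
    simpa using this n
  · intro q
    let s : ℕ → R := fun n => Nat.rec 0 (fun _ p => p + (q - φ p)) n
    have hs : ∀ n, s (n + 1) = s n + (q - φ (s n)) := fun n => rfl
    have h1 : ∀ n, q - φ (s n) ∈ I ^ n := by
      intro n
      induction n with
      | zero => simp
      | succ n ih =>
        have := h n _ ih
        rw [hs, map_add]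
        have e : q - (φ (s n) + φ (q - φ (s n))) = - (φ (q - φ (s n)) - (q - φ (s n))) := by ring
        rw [e]
        exact (Ideal.neg_mem_iff _).mpr this
    have h2 : ∀ m n, m ≤ n → s m ≡ s n [SMOD (I ^ m • ⊤ : Submodule R R)] := by
      intro m n hmn
      induction n, hmn using Nat.le_induction with
      | base => rfl
      | succ n hmn ih =>
        refine ih.trans ?_
        rw [SModEq.sub_mem, hs]
        have : s n - (s n + (q - φ (s n))) = -(q - φ (s n)) := by ring
        rw [this, Submodule.neg_mem_iff]
        simpa using Ideal.pow_le_pow_right hmn (h1 n)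
    obtain ⟨L, hL⟩ := IsPrecomplete.prec (I := I) inferInstance (f := s) (fun {m n} => h2 m n)
    have hφ : ∀ n, ∀ p ∈ I ^ n, φ p ∈ I ^ n := fun n p hp => by
      have := Ideal.add_mem _ (Ideal.pow_le_pow_right (Nat.le_succ n) (h n p hp)) hp
      simpa using this
    refine ⟨L, ?_⟩
    rw [← sub_eq_zero]
    refine IsHausdorff.haus (I := I) inferInstance _ fun n => ?_
    rw [SModEq.zero]
    have h3 := hL n
    rw [SModEq.sub_mem] at h3
    have h3' : s n - L ∈ I ^ n := by simpa using h3
    have h4 := hφ n _ h3'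
    rw [map_sub] at h4
    have h5 := Ideal.add_mem _ h4 (h1 n)
    have : φ L - q = -(φ (s n) - φ L + (q - φ (s n))) := by ring
    rw [this, Submodule.neg_mem_iff]
    simpa using h5

theorem unip_of_gen {R : Type*} [CommRing R] (I : Ideal R) (φ : R →+* R)
    (h0 : ∀ p, φ p - p ∈ I) (h1 : ∀ p ∈ I, φ p - p ∈ I ^ 2) :
    ∀ n, ∀ p ∈ I ^ n, φ p - p ∈ I ^ (n + 1) := by
  intro n
  induction n with
  | zero => intro p _; simpa using h0 p
  | succ n ih =>
    intro p hp
    rw [pow_succ] at hp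
    induction hp using Submodule.mul_induction_on' with
    | mem_mul_mem a ha b hb =>
      have e : φ (a * b) - a * b = (φ a - a) * φ b + a * (φ b - b) := by rw [map_mul]; ring
      rw [e]
      have hφb : φ b ∈ I := by simpa using Ideal.add_mem _ (h0 b) hb
      refine Ideal.add_mem _ ?_ ?_
      · have := Ideal.mul_mem_mul (ih a ha) hφb
        rwa [← pow_succ] at this
      · have := Ideal.mul_mem_mul ha (h1 b hb)
        rwa [← pow_add] at this
    | add x hx y hy h h' =>
      have e : φ (x + y) - (x + y) = (φ x - x) + (φ y - y) := by rw [map_add]; ring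
      rw [e]; exact Ideal.add_mem _ h h'

theorem sqrt_series [CharZero K] (p : MvPowerSeries (Fin 3) K)
    (hp : MvPowerSeries.constantCoeff p = 1) :
    ∃ s : MvPowerSeries (Fin 3) K, s ^ 2 = p ∧ MvPowerSeries.constantCoeff s = 1 := by
  let I : Ideal (MvPowerSeries (Fin 3) K) := Ideal.span (Set.range MvPowerSeries.X)
  have : IsAdicComplete I (MvPowerSeries (Fin 3) K) := inferInstance
  have hH : HenselianRing (MvPowerSeries (Fin 3) K) I := inferInstance
  obtain ⟨s, h1, h2⟩ := hH.is_henselian (Polynomial.X ^ 2 - Polynomial.C p)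
    (Polynomial.monic_X_pow_sub_C p two_ne_zero) 1 (by
      rw [maxI_iff]; simp [hp]) (by
      have : IsUnit (Polynomial.eval 1 (Polynomial.derivative (Polynomial.X ^ 2 - Polynomial.C p))) := by
        rw [MvPowerSeries.isUnit_iff_constantCoeff]
        simp
      exact this.map _)
  refine ⟨s, ?_, ?_⟩
  · have := h1
    simp [Polynomial.IsRoot] at this
    linear_combination this
  · rw [maxI_iff] at h2
    simpa [sub_eq_zero] using h2

theorem exists_gram [IsAlgClosed K] [CharZero K] (H : Matrix (Fin 3) (Fin 3) K)
    (hs : H.transpose = H) (hdet : H.det ≠ 0) :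
    ∃ B : Matrix (Fin 3) (Fin 3) K, B.det ≠ 0 ∧ B.transpose * B = H := by
  have : Invertible (2 : K) := invertibleOfNonzero two_ne_zero
  have hsymm : LinearMap.IsSymm (Matrix.toBilin' H) := by
    constructor
    intro x y
    simp only [Matrix.toBilin'_apply', RingHom.id_apply]
    rw [dotProduct_comm, ← Matrix.vecMul_transpose, hs, ← Matrix.dotProduct_mulVec]
  obtain ⟨v0, hv0⟩ := LinearMap.BilinForm.exists_orthogonal_basis hsymm
  let v := v0.reindex (finCongr (by simp : Module.finrank K (Fin 3 → K) = 3))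
  let P : Matrix (Fin 3) (Fin 3) K := (Pi.basisFun K (Fin 3)).toMatrix v
  have hP : ∀ i j, P i j = v j i := fun i j => by simp [P, Module.Basis.toMatrix_apply]
  have hPdet : P.det ≠ 0 := by
    have h1 : P * v.toMatrix (Pi.basisFun K (Fin 3)) = 1 := Module.Basis.toMatrix_mul_toMatrix_flip _ _
    intro h
    have := congrArg Matrix.det h1
    rw [Matrix.det_mul, h] at this
    simp at this
  have hD : ∃ D : Fin 3 → K, P.transpose * H * P = Matrix.diagonal D := by
    refine ⟨fun i => (P.transpose * H * P) i i, ?_⟩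
    ext i j
    by_cases h : i = j
    · subst h; simp
    · rw [Matrix.diagonal_apply_ne _ h]
      have h1 : Matrix.toBilin' H (v i) (v j) = 0 := by
        simp only [v, Module.Basis.reindex_apply]
        exact hv0 (by simpa using h)
      rw [Matrix.toBilin'_apply'] at h1
      rw [← h1, Matrix.mul_assoc, Matrix.mul_apply]
      simp only [dotProduct, Matrix.mulVec, Matrix.transpose_apply, Matrix.mul_apply, hP]
  obtain ⟨D, hD⟩ := hD
  have hD0 : ∀ i, D i ≠ 0 := by
    have := congrArg Matrix.det hD
    rw [Matrix.det_mul, Matrix.det_mul, Matrix.det_transpose, Matrix.det_diagonal] at this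
    have h2 : ∏ i, D i ≠ 0 := by
      rw [← this]; exact mul_ne_zero (mul_ne_zero hPdet hdet) hPdet
    intro i
    exact (Finset.prod_ne_zero_iff.mp h2) i (Finset.mem_univ _)
  choose s hs' using fun i => IsAlgClosed.exists_eq_mul_self (D i)
  have hs0 : ∀ i, s i ≠ 0 := fun i h => hD0 i (by rw [hs' i, h, zero_mul])
  have hPu : IsUnit P.det := isUnit_iff_ne_zero.mpr hPdet
  refine ⟨Matrix.diagonal s * P⁻¹, ?_, ?_⟩
  · rw [Matrix.det_mul, Matrix.det_diagonal, Matrix.det_nonsing_inv]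
    refine mul_ne_zero (Finset.prod_ne_zero_iff.mpr fun i _ => hs0 i) ?_
    simpa using hPdet
  · have hDs : Matrix.diagonal s * Matrix.diagonal s = Matrix.diagonal D := by
      rw [Matrix.diagonal_mul_diagonal]
      congr 1; ext i; exact (hs' i).symm
    rw [Matrix.transpose_mul, Matrix.diagonal_transpose, Matrix.mul_assoc,
      ← Matrix.mul_assoc (Matrix.diagonal s), hDs, ← hD]
    have h1 : P * P⁻¹ = 1 := Matrix.mul_nonsing_inv _ hPu
    have h2 : (P⁻¹).transpose * P.transpose = 1 := by
      rw [← Matrix.transpose_mul, h1, Matrix.transpose_one]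
    calc (P⁻¹).transpose * (P.transpose * H * P * P⁻¹)
        = ((P⁻¹).transpose * P.transpose) * H * (P * P⁻¹) := by simp only [Matrix.mul_assoc]
      _ = H := by rw [h1, h2]; simp

theorem constCoeff_algHom (φ : MvPowerSeries (Fin 3) K →ₐ[K] MvPowerSeries (Fin 3) K)
    (hφ : ∀ i, MvPowerSeries.constantCoeff (φ (MvPowerSeries.X i)) = 0)
    (p : MvPowerSeries (Fin 3) K) :
    MvPowerSeries.constantCoeff (φ p) = MvPowerSeries.constantCoeff p := by
  have h1 : p - algebraMap K _ (MvPowerSeries.constantCoeff p) ∈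
      (Ideal.span (Set.range MvPowerSeries.X) : Ideal (MvPowerSeries (Fin 3) K)) := by
    rw [maxI_iff]; simp [MvPowerSeries.algebraMap_apply]
  have h2 : (Ideal.span (Set.range MvPowerSeries.X) : Ideal (MvPowerSeries (Fin 3) K)) ≤
      RingHom.ker ((MvPowerSeries.constantCoeff (σ := Fin 3) (R := K)).comp (φ : _ →+* _)) := by
    rw [Ideal.span_le]
    rintro _ ⟨i, rfl⟩
    simpa using hφ i
  have h3 := h2 h1
  rw [RingHom.mem_ker] at h3
  simp only [map_sub, RingHom.comp_apply, RingHom.coe_coe, AlgHom.commutes, sub_eq_zero] at h3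
  rw [h3]
  simp [MvPowerSeries.algebraMap_apply]

theorem algHom_bij (φ : MvPowerSeries (Fin 3) K →ₐ[K] MvPowerSeries (Fin 3) K)
    (N : Matrix (Fin 3) (Fin 3) (MvPowerSeries (Fin 3) K))
    (hN : ∀ i j, MvPowerSeries.constantCoeff (N i j) = if i = j then 1 else 0)
    (hφ : ∀ i, φ (MvPowerSeries.X i) = ∑ j, N i j * MvPowerSeries.X j) :
    Function.Bijective φ := by
  have hc := constCoeff_algHom φ (fun i => by rw [hφ]; simp)
  have hX : ∀ i, MvPowerSeries.X i ∈
      (Ideal.span (Set.range MvPowerSeries.X) : Ideal (MvPowerSeries (Fin 3) K)) :=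
    fun i => Ideal.subset_span ⟨i, rfl⟩
  refine bij_of_unip (Ideal.span (Set.range MvPowerSeries.X) : Ideal (MvPowerSeries (Fin 3) K))
    (φ : MvPowerSeries (Fin 3) K →+* MvPowerSeries (Fin 3) K) (unip_of_gen _ _ ?_ ?_)
  · intro p
    rw [maxI_iff]
    simp [hc]
  · intro p hp
    induction hp using Submodule.span_induction with
    | mem x hx =>
      obtain ⟨i, rfl⟩ := hx
      have e : (φ (MvPowerSeries.X i)) - MvPowerSeries.X i =
          ∑ j, (N i j - if i = j then 1 else 0) * MvPowerSeries.X j := by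
        rw [hφ]; simp [sub_mul, Finset.sum_sub_distrib]
      simp only [RingHom.coe_coe]
      rw [e, pow_two]
      refine Ideal.sum_mem _ fun j _ => Ideal.mul_mem_mul ?_ (hX j)
      rw [maxI_iff, map_sub, hN]
      split_ifs <;> simp
    | zero => simp
    | add x y _ _ h h' =>
      simp only [map_add]
      have := Ideal.add_mem _ h h'
      convert this using 1
      ring
    | smul a x hx h =>
      simp only [smul_eq_mul, map_mul, RingHom.coe_coe] at h ⊢
      have e : φ a * φ x - a * x = φ a * (φ x - x) + (φ a - a) * x := by ring
      rw [e]
      refine Ideal.add_mem _ (Ideal.mul_mem_left _ _ h) ?_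
      rw [pow_two]
      refine Ideal.mul_mem_mul ?_ hx
      rw [maxI_iff]; simp [hc]

theorem subst_equiv (A : Matrix (Fin 3) (Fin 3) (MvPowerSeries (Fin 3) K))
    (B : Matrix (Fin 3) (Fin 3) K) (hB : B.det ≠ 0)
    (hA : ∀ i j, MvPowerSeries.constantCoeff (A i j) = B i j) :
    ∃ φ : MvPowerSeries (Fin 3) K ≃ₐ[K] MvPowerSeries (Fin 3) K,
      ∀ i, φ (MvPowerSeries.X i) = ∑ j, A i j * MvPowerSeries.X j := by
  have hs : MvPowerSeries.HasSubst (S := K) (fun i => ∑ j, A i j * MvPowerSeries.X j) :=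
    MvPowerSeries.hasSubst_of_constantCoeff_zero (fun i => by simp)
  have ht : MvPowerSeries.HasSubst (S := K)
      (fun i => ∑ j, MvPowerSeries.C (B⁻¹ i j) * MvPowerSeries.X j : Fin 3 → MvPowerSeries (Fin 3) K) :=
    MvPowerSeries.hasSubst_of_constantCoeff_zero (fun i => by simp)
  let φ : MvPowerSeries (Fin 3) K →ₐ[K] MvPowerSeries (Fin 3) K := MvPowerSeries.substAlgHom hs
  let ψ : MvPowerSeries (Fin 3) K →ₐ[K] MvPowerSeries (Fin 3) K := MvPowerSeries.substAlgHom ht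
  have hφ : ∀ i, φ (MvPowerSeries.X i) = ∑ j, A i j * MvPowerSeries.X j :=
    fun i => MvPowerSeries.substAlgHom_X hs i
  have hψ : ∀ i, ψ (MvPowerSeries.X i) = ∑ j, MvPowerSeries.C (B⁻¹ i j) * MvPowerSeries.X j :=
    fun i => MvPowerSeries.substAlgHom_X ht i
  have hC : ∀ (χ : MvPowerSeries (Fin 3) K →ₐ[K] MvPowerSeries (Fin 3) K) c,
      χ (MvPowerSeries.C c) = MvPowerSeries.C c := fun χ c => by
    have := χ.commutes c
    simpa [MvPowerSeries.algebraMap_apply] using this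
  have hu : IsUnit B.det := isUnit_iff_ne_zero.mpr hB
  have b1 : Function.Bijective (φ.comp ψ) := by
    refine algHom_bij _ (fun i k => ∑ j, MvPowerSeries.C (B⁻¹ i j) * A j k) ?_ ?_
    · intro i k
      have := congrFun (congrFun (Matrix.nonsing_inv_mul B hu) i) k
      rw [Matrix.mul_apply, Matrix.one_apply] at this
      rw [← this]
      simp [hA]
    · intro i
      rw [AlgHom.comp_apply, hψ, map_sum]
      simp only [map_mul, hC, hφ, Finset.mul_sum, Finset.sum_mul]
      rw [Finset.sum_comm]
      simp only [mul_assoc]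
  have b2 : Function.Bijective (ψ.comp φ) := by
    refine algHom_bij _ (fun i k => ∑ j, ψ (A i j) * MvPowerSeries.C (B⁻¹ j k)) ?_ ?_
    · intro i k
      have := congrFun (congrFun (Matrix.mul_nonsing_inv B hu) i) k
      rw [Matrix.mul_apply, Matrix.one_apply] at this
      rw [← this]
      simp [constCoeff_algHom ψ (fun i => by rw [hψ]; simp), hA]
    · intro i
      rw [AlgHom.comp_apply, hφ, map_sum]
      simp only [map_mul, hψ, Finset.mul_sum, Finset.sum_mul]
      rw [Finset.sum_comm]
      simp only [mul_assoc]
  have b : Function.Bijective φ :=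
    ⟨Function.Injective.of_comp (f := ψ) (g := φ) b2.1, Function.Surjective.of_comp (f := φ) (g := ψ) b1.2⟩
  exact ⟨AlgEquiv.ofBijective φ b, fun i => by simpa using hφ i⟩

theorem cholesky [CharZero K] (M : Matrix (Fin 3) (Fin 3) (MvPowerSeries (Fin 3) K))
    (hs : M.transpose = M)
    (hM : ∀ i j, MvPowerSeries.constantCoeff (M i j) = if i = j then 1 else 0) :
    ∃ L : Matrix (Fin 3) (Fin 3) (MvPowerSeries (Fin 3) K), L.transpose * L = M ∧
      ∀ i j, MvPowerSeries.constantCoeff (L i j) = if i = j then 1 else 0 := by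
  have h10 : M 1 0 = M 0 1 := congrFun (congrFun hs 0) 1
  have h20 : M 2 0 = M 0 2 := congrFun (congrFun hs 0) 2
  have h21 : M 2 1 = M 1 2 := congrFun (congrFun hs 1) 2
  have hinv : ∀ s : MvPowerSeries (Fin 3) K, MvPowerSeries.constantCoeff s = 1 →
      ∃ t, s * t = 1 ∧ MvPowerSeries.constantCoeff t = 1 := fun s hs => by
    refine ⟨s⁻¹, MvPowerSeries.mul_inv_cancel s (by rw [hs]; exact one_ne_zero), ?_⟩
    simp [hs]
  obtain ⟨s, s2, sc⟩ := sqrt_series (M 0 0) (by simp [hM])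
  obtain ⟨si, hsi, sic⟩ := hinv s sc
  obtain ⟨t, t2, tc⟩ := sqrt_series (M 1 1 - (M 0 1 * si) ^ 2) (by simp [hM])
  obtain ⟨ti, hti, tic⟩ := hinv t tc
  obtain ⟨r, r2, rc⟩ := sqrt_series
    (M 2 2 - (M 0 2 * si) ^ 2 - ((M 1 2 - M 0 1 * si * (M 0 2 * si)) * ti) ^ 2) (by simp [hM])
  refine ⟨!![s, M 0 1 * si, M 0 2 * si; 0, t, (M 1 2 - M 0 1 * si * (M 0 2 * si)) * ti; 0, 0, r],
    ?_, ?_⟩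
  · ext1 i j
    fin_cases i <;> fin_cases j <;>
      simp [Matrix.mul_apply, Fin.sum_univ_three, h10, h20, h21]
    · linear_combination s2
    · linear_combination M 0 1 * hsi
    · linear_combination M 0 2 * hsi
    · linear_combination M 0 1 * hsi
    · linear_combination t2
    · linear_combination (M 1 2 - M 0 1 * si * (M 0 2 * si)) * hti
    · linear_combination M 0 2 * hsi
    · linear_combination (M 1 2 - M 0 1 * si * (M 0 2 * si)) * hti
    · linear_combination r2
  · intro i j
    fin_cases i <;> fin_cases j <;> simp [hM, sc, tc, rc]

theorem morse [IsAlgClosed K] [CharZero K] (H : Matrix (Fin 3) (Fin 3) (MvPowerSeries (Fin 3) K))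
    (hs : H.transpose = H) (hdet : (H.map MvPowerSeries.constantCoeff).det ≠ 0) :
    ∃ e : MvPowerSeries (Fin 3) K ≃ₐ[K] MvPowerSeries (Fin 3) K,
      e (∑ i, ∑ j, MvPowerSeries.X i * H i j * MvPowerSeries.X j) =
      (MvPowerSeries.X 0) ^ 2 + (MvPowerSeries.X 1) ^ 2 + (MvPowerSeries.X 2) ^ 2 := by
  obtain ⟨B, hB, hBH⟩ := exists_gram (H.map MvPowerSeries.constantCoeff)
    (by rw [← Matrix.transpose_map, hs]) hdet
  have hu : IsUnit B.det := isUnit_iff_ne_zero.mpr hB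
  let BC : Matrix (Fin 3) (Fin 3) (MvPowerSeries (Fin 3) K) := B.map MvPowerSeries.C
  let BI : Matrix (Fin 3) (Fin 3) (MvPowerSeries (Fin 3) K) := B⁻¹.map MvPowerSeries.C
  have hBB : BI * BC = 1 := by
    simp only [BC, BI]
    rw [← Matrix.map_mul, Matrix.nonsing_inv_mul B hu]
    simp
  have hcc : ∀ N : Matrix (Fin 3) (Fin 3) K,
      (N.map (MvPowerSeries.C (σ := Fin 3))).map MvPowerSeries.constantCoeff = N := by
    intro N; ext; simp
  obtain ⟨L, hL, hLc⟩ := cholesky (BI.transpose * H * BI)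
    (by rw [Matrix.transpose_mul, Matrix.transpose_mul, hs, Matrix.transpose_transpose, Matrix.mul_assoc]) (by
      have h1 : (BI.transpose * H * BI).map MvPowerSeries.constantCoeff = 1 := by
        rw [Matrix.map_mul, Matrix.map_mul, ← hBH, ← Matrix.transpose_map]
        simp only [BI]
        rw [hcc]
        have h1 : B * B⁻¹ = 1 := Matrix.mul_nonsing_inv _ hu
        have h2 : (B⁻¹).transpose * B.transpose = 1 := by
          rw [← Matrix.transpose_mul, h1, Matrix.transpose_one]
        calc (B⁻¹).transpose * (B.transpose * B) * B⁻¹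
            = ((B⁻¹).transpose * B.transpose) * (B * B⁻¹) := by simp only [Matrix.mul_assoc]
          _ = 1 := by rw [h1, h2]; simp
      intro i j
      have := congrFun (congrFun h1 i) j
      rwa [Matrix.one_apply] at this)
  obtain ⟨φ, hφ⟩ := subst_equiv (L * BC) B hB (by
    intro i j
    rw [Matrix.mul_apply, map_sum]
    simp [hLc, BC])
  have hH : (L * BC).transpose * (L * BC) = H := by
    have h2 : BC.transpose * BI.transpose = 1 := by
      rw [← Matrix.transpose_mul, hBB, Matrix.transpose_one]
    calc (L * BC).transpose * (L * BC) = BC.transpose * (L.transpose * L) * BC := by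
          rw [Matrix.transpose_mul]; simp only [Matrix.mul_assoc]
      _ = (BC.transpose * BI.transpose) * H * (BI * BC) := by
          rw [hL]; simp only [Matrix.mul_assoc]
      _ = H := by rw [h2, hBB]; simp
  refine ⟨φ.symm, ?_⟩
  rw [AlgEquiv.symm_apply_eq]
  simp only [map_add, map_pow, hφ]
  rw [← hH]
  generalize L * BC = A
  simp only [Matrix.mul_apply, Matrix.transpose_apply, Fin.sum_univ_three]
  ring

theorem mem_vars_of_eval_zero (p : MvPolynomial (Fin 3) K) (h : eval 0 p = 0) :
    ∃ q : Fin 3 → MvPolynomial (Fin 3) K, p = ∑ i, X i * q i := by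
  have h1 : p ∈ Ideal.span (Set.range (X : Fin 3 → MvPolynomial (Fin 3) K)) := by
    have h2 := MvPolynomial.mem_ideal_span_X_image (x := p) (s := Set.univ)
    rw [Set.image_univ] at h2
    rw [h2]
    intro m hm
    by_contra hcon
    push Not at hcon
    have : m = 0 := by ext i; simpa using hcon i (Set.mem_univ _)
    subst this
    rw [MvPolynomial.mem_support_iff] at hm
    apply hm
    rw [← h]
    simp [MvPolynomial.eval_zero, MvPolynomial.constantCoeff_eq]
  obtain ⟨c, hc⟩ := (Ideal.mem_span_range_iff_exists_fun).1 h1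
  exact ⟨c, by rw [← hc]; simp [mul_comm]⟩

theorem nondeg_isA1 [IsAlgClosed K] [CharZero K] (G : MvPolynomial (Fin 3) K) (h0 : eval 0 G = 0)
    (h1 : ∀ i, eval 0 (pderiv i G) = 0)
    (h2 : ∀ u : Fin 3 → K, (∀ i, ∑ j, eval 0 (pderiv j (pderiv i G)) * u j = 0) → u = 0) :
    IsATypeSing G 1 := by
  obtain ⟨G1, hG1⟩ := mem_vars_of_eval_zero G h0
  have hG1z : ∀ i, eval 0 (G1 i) = 0 := by
    intro i
    have := h1 i
    rw [hG1] at this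
    fin_cases i <;> simpa [Fin.sum_univ_three, Derivation.leibniz, pderiv_X, Pi.single_apply] using this
  choose G2 hG2 using fun i => mem_vars_of_eval_zero (G1 i) (hG1z i)
  have hG : G = ∑ i, ∑ j, X i * G2 i j * X j := by
    rw [hG1]
    refine Finset.sum_congr rfl fun i _ => ?_
    rw [hG2, Finset.mul_sum]
    exact Finset.sum_congr rfl fun j _ => by ring
  have hess : ∀ i j, eval 0 (pderiv j (pderiv i G)) = eval 0 (G2 i j) + eval 0 (G2 j i) := by
    intro i j
    rw [hG]
    fin_cases i <;> fin_cases j <;>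
      simp [Fin.sum_univ_three, Derivation.leibniz, pderiv_X, Pi.single_apply] <;> ring
  let Hp : Matrix (Fin 3) (Fin 3) (MvPolynomial (Fin 3) K) :=
    Matrix.of fun i j => C (2⁻¹ : K) * (G2 i j + G2 j i)
  let H : Matrix (Fin 3) (Fin 3) (MvPowerSeries (Fin 3) K) :=
    Matrix.of fun i j => (Hp i j : MvPowerSeries (Fin 3) K)
  have hs : H.transpose = H := by
    ext1 i j
    simp [H, Hp, add_comm]
  have hcc : ∀ i j, MvPowerSeries.constantCoeff (H i j) = 2⁻¹ * eval 0 (pderiv j (pderiv i G)) := by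
    intro i j
    rw [hess]
    have hc : ∀ p : MvPolynomial (Fin 3) K,
        MvPowerSeries.constantCoeff (p : MvPowerSeries (Fin 3) K) = eval 0 p := by
      intro p
      rw [← MvPowerSeries.coeff_zero_eq_constantCoeff_apply, MvPolynomial.coeff_coe]
      simp [MvPolynomial.eval_zero, MvPolynomial.constantCoeff_eq]
    simp only [H, Hp, Matrix.of_apply, hc, map_mul, map_add, eval_C]
  have hdet : (H.map MvPowerSeries.constantCoeff).det ≠ 0 := by
    intro hd
    obtain ⟨u, hu, huz⟩ := Matrix.exists_mulVec_eq_zero_iff.2 hd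
    apply hu
    apply h2
    intro i
    have := congrFun huz i
    simp only [Matrix.mulVec, dotProduct, Matrix.map_apply, hcc, Pi.zero_apply, mul_assoc,
      ← Finset.mul_sum] at this
    simpa using this
  obtain ⟨e, he⟩ := morse H hs hdet
  refine ⟨e, ?_⟩
  have hGH : G = ∑ i, ∑ j, X i * Hp i j * X j := by
    have h3 : C (2⁻¹ : K) * 2 = (1 : MvPolynomial (Fin 3) K) := by
      rw [← map_ofNat (C (σ := Fin 3) (R := K)) 2, ← C_mul]; simp
    have h4 : ∑ i, ∑ j, X i * Hp i j * X j = C (2⁻¹ : K) * 2 * ∑ i, ∑ j, X i * G2 i j * X j := by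
      simp only [Hp, Fin.sum_univ_three, Matrix.of_apply]
      ring
    rw [h4, h3, one_mul]; exact hG
  have : (G : MvPowerSeries (Fin 3) K) =
      ∑ i, ∑ j, MvPowerSeries.X i * H i j * MvPowerSeries.X j := by
    conv_lhs => rw [hGH]
    simp [Fin.sum_univ_three, H]
  rw [this, he]

theorem deriv_aeval {σ : Type*} [Fintype σ] (γ : σ → Polynomial K) (f : MvPolynomial σ K) :
    Polynomial.derivative (aeval γ f) =
      ∑ i, Polynomial.derivative (γ i) * aeval γ (pderiv i f) := by
  classical
  induction f using MvPolynomial.induction_on with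
  | C a => simp [MvPolynomial.aeval_C, Polynomial.algebraMap_eq]
  | add p q hp hq => simp [hp, hq, mul_add, Finset.sum_add_distrib]
  | mul_X p k hp =>
    rw [map_mul, Polynomial.derivative_mul, hp]
    simp only [Derivation.leibniz, pderiv_X, map_add, smul_eq_mul, map_mul, aeval_X, mul_add,
      Finset.sum_add_distrib]
    rw [add_comm]
    congr 1
    · rw [Finset.sum_eq_single k]
      · simp [mul_comm]
      · intro b _ hb; simp [Pi.single_apply, hb.symm]
      · simp
    · rw [Finset.sum_mul]
      exact Finset.sum_congr rfl fun i _ => by ring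

theorem jet_coeff0 (b v w : Fin 3 → K) (f : MvPolynomial (Fin 3) K) :
    (aeval (jet b v w) f).coeff 0 = eval b f := by
  rw [Polynomial.coeff_zero_eq_aeval_zero, ← AlgHom.comp_apply, MvPolynomial.comp_aeval]
  rw [← MvPolynomial.coe_aeval_eq_eval]
  change aeval _ f = aeval b f
  congr 2
  funext i
  simp [jet]

theorem jet_coeff1 (b v w : Fin 3 → K) (f : MvPolynomial (Fin 3) K) :
    (aeval (jet b v w) f).coeff 1 = ∑ i, v i * eval b (pderiv i f) := by
  have h := congrArg (fun p => Polynomial.coeff p 0) (deriv_aeval (jet b v w) f)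
  simp only [Polynomial.coeff_derivative, Polynomial.finset_sum_coeff, Polynomial.mul_coeff_zero,
    jet_coeff0] at h
  simpa [jet] using h

theorem jet_coeff2 (b v w : Fin 3 → K) (f : MvPolynomial (Fin 3) K) :
    2 * (aeval (jet b v w) f).coeff 2 = 2 * ∑ i, w i * eval b (pderiv i f) +
      ∑ i, v i * ∑ j, v j * eval b (pderiv j (pderiv i f)) := by
  have h := congrArg (fun p => Polynomial.coeff p 1) (deriv_aeval (jet b v w) f)
  simp only [Polynomial.coeff_derivative, Polynomial.finset_sum_coeff, Polynomial.mul_coeff_one,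
    jet_coeff0, jet_coeff1] at h
  norm_num at h
  rw [mul_comm, h]
  simp [jet, Fin.sum_univ_three]
  ring

theorem jet_dvd2 {b v w : Fin 3 → K} {f : MvPolynomial (Fin 3) K} (h0 : eval b f = 0)
    (h1 : ∑ i, v i * eval b (pderiv i f) = 0) : Polynomial.X ^ 2 ∣ aeval (jet b v w) f := by
  rw [Polynomial.X_pow_dvd_iff]
  intro d hd
  interval_cases d
  · rw [jet_coeff0, h0]
  · rw [jet_coeff1, h1]

theorem jet_dvd3 [CharZero K] {b v w : Fin 3 → K} {f : MvPolynomial (Fin 3) K} (h0 : eval b f = 0)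
    (h1 : ∑ i, v i * eval b (pderiv i f) = 0)
    (h2 : 2 * ∑ i, w i * eval b (pderiv i f) +
      ∑ i, v i * ∑ j, v j * eval b (pderiv j (pderiv i f)) = 0) :
    Polynomial.X ^ 3 ∣ aeval (jet b v w) f := by
  rw [Polynomial.X_pow_dvd_iff]
  intro d hd
  interval_cases d
  · rw [jet_coeff0, h0]
  · rw [jet_coeff1, h1]
  · have := jet_coeff2 b v w f
    rw [h2] at this
    simpa using this

theorem pderiv_comm' {σ : Type*} (i j : σ) (p : MvPolynomial σ K) :
    pderiv i (pderiv j p) = pderiv j (pderiv i p) := by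
  classical
  induction p using MvPolynomial.induction_on with
  | C a => simp
  | add p q hp hq => simp [hp, hq]
  | mul_X p k hp =>
    simp only [Derivation.leibniz, pderiv_X, map_add, smul_eq_mul, hp]
    have h : ∀ a b : σ, pderiv a ((Pi.single b 1 : σ → MvPolynomial σ K) k) = 0 := by
      intro a b
      by_cases h : b = k
      · subst h; simp
      · simp [Pi.single_apply, Ne.symm h]
    simp only [h]
    ring

theorem pderiv_zero_rename (p : MvPolynomial (Fin 3) K) :
    pderiv (0 : Fin 4) (rename Fin.succ p) = 0 := by
  induction p using MvPolynomial.induction_on with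
  | C a => simp
  | add p q hp hq => simp [hp, hq]
  | mul_X p k hp =>
    simp [Derivation.leibniz, pderiv_X, hp]

theorem pderiv_succ_rename (j : Fin 3) (p : MvPolynomial (Fin 3) K) :
    pderiv (j.succ : Fin 4) (rename Fin.succ p) = rename Fin.succ (pderiv j p) :=
  pderiv_rename (Fin.succ_injective 3) _ _

theorem pderiv_zero_F (f g : MvPolynomial (Fin 3) K) :
    pderiv (0 : Fin 4) (X 0 * rename Fin.succ f + rename Fin.succ g) = rename Fin.succ f := by
  simp [Derivation.leibniz, pderiv_zero_rename]

theorem pderiv_succ_F (j : Fin 3) (f g : MvPolynomial (Fin 3) K) :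
    pderiv (j.succ : Fin 4) (X 0 * rename Fin.succ f + rename Fin.succ g) =
      X 0 * rename Fin.succ (pderiv j f) + rename Fin.succ (pderiv j g) := by
  simp [Derivation.leibniz, pderiv_succ_rename, pderiv_X]

theorem sing_data {f g : MvPolynomial (Fin 3) K} {P : Fin 4 → K}
    (h : SingularAt (X 0 * rename Fin.succ f + rename Fin.succ g) P) :
    eval (P ∘ Fin.succ) f = 0 ∧ eval (P ∘ Fin.succ) g = 0 ∧
      ∀ j, P 0 * eval (P ∘ Fin.succ) (pderiv j f) + eval (P ∘ Fin.succ) (pderiv j g) = 0 := by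
  obtain ⟨h0, h1⟩ := h
  have hf : eval (P ∘ Fin.succ) f = 0 := by
    have := h1 0
    rwa [pderiv_zero_F, eval_rename] at this
  refine ⟨hf, ?_, fun j => ?_⟩
  · simpa [eval_rename, hf] using h0
  · have := h1 j.succ
    rw [pderiv_succ_F] at this
    simpa [eval_rename] using this

theorem grad_ne {f g : MvPolynomial (Fin 3) K}
    (hnocsing : ∀ b : Fin 3 → K, b ≠ 0 →
      ¬((eval b f = 0 ∧ ∀ j, eval b (pderiv j f) = 0) ∧
        (eval b g = 0 ∧ ∀ j, eval b (pderiv j g) = 0))) {P : Fin 4 → K}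
    (h : SingularAt (X 0 * rename Fin.succ f + rename Fin.succ g) P) (hb : P ∘ Fin.succ ≠ 0) :
    ∃ j, eval (P ∘ Fin.succ) (pderiv j f) ≠ 0 := by
  obtain ⟨h0, h1, h2⟩ := sing_data h
  by_contra hcon
  push Not at hcon
  refine hnocsing _ hb ⟨⟨h0, hcon⟩, h1, fun j => ?_⟩
  have := h2 j
  rwa [hcon, mul_zero, zero_add] at this

theorem nonprop {n : ℕ} {f g : MvPolynomial (Fin 3) K} (hf : f.IsHomogeneous (n + 1))
    (hg : g.IsHomogeneous (n + 2))
    (hnocsing : ∀ b : Fin 3 → K, b ≠ 0 →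
      ¬((eval b f = 0 ∧ ∀ j, eval b (pderiv j f) = 0) ∧
        (eval b g = 0 ∧ ∀ j, eval b (pderiv j g) = 0))) {P Q : Fin 4 → K}
    (hP : SingularAt (X 0 * rename Fin.succ f + rename Fin.succ g) P) (hPb : P ∘ Fin.succ ≠ 0)
    (hQ : SingularAt (X 0 * rename Fin.succ f + rename Fin.succ g) Q) (hQb : Q ∘ Fin.succ ≠ 0)
    (c : K) (hc : Q ∘ Fin.succ = c • (P ∘ Fin.succ)) : Q = c • P := by
  obtain ⟨j, hj⟩ := grad_ne hnocsing hP hPb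
  obtain ⟨-, -, h1⟩ := sing_data hP
  obtain ⟨-, -, h2⟩ := sing_data hQ
  have hc0 : c ≠ 0 := by
    rintro rfl
    exact hQb (by rw [hc, zero_smul])
  have h1 := h1 j
  have h2 := h2 j
  rw [hc, eval_smul_hom (n := n) (by simpa using hf.pderiv (i := j)),
    eval_smul_hom (n := n + 1) (by simpa using hg.pderiv (i := j))] at h2
  have h3 : (c ^ n * eval (P ∘ Fin.succ) (pderiv j f)) * (Q 0 - c * P 0) = 0 := by
    linear_combination h2 - c ^ (n + 1) * h1
  have h4 : Q 0 = c * P 0 := by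
    rcases mul_eq_zero.1 h3 with h | h
    · exact absurd h (mul_ne_zero (pow_ne_zero _ hc0) hj)
    · exact sub_eq_zero.1 h
  funext i
  refine Fin.cases ?_ (fun k => ?_) i
  · simpa using h4
  · simpa using congrFun hc k

theorem exists_tangent (a b : Fin 3 → K) (ha : ∃ j, a j ≠ 0) :
    ∃ v : Fin 3 → K, (∑ i, v i * a i = 0) ∧ ∀ c : K, v ≠ c • b := by
  by_contra hcon
  push Not at hcon
  let φ : (Fin 3 → K) →ₗ[K] K := Fintype.linearCombination K a
  have hle : LinearMap.ker φ ≤ K ∙ b := by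
    intro v hv
    obtain ⟨c, hc⟩ := hcon v (by simpa [φ, Fintype.linearCombination_apply] using hv)
    exact Submodule.mem_span_singleton.2 ⟨c, hc.symm⟩
  have h1 := Submodule.finrank_mono hle
  have h2 := finrank_span_le_card (R := K) ({b} : Set (Fin 3 → K))
  have h3 := LinearMap.finrank_range_add_finrank_ker φ
  have h4 := Submodule.finrank_le (LinearMap.range φ)
  simp at h2 h3 h4
  omega

/-- a jet along which both polynomials vanish to order `k` -/
def HasJet (f g : MvPolynomial (Fin 3) K) (b : Fin 3 → K) (k : ℕ) : Prop :=
  ∃ v w : Fin 3 → K, (∀ c : K, v ≠ c • b) ∧ Polynomial.X ^ k ∣ aeval (jet b v w) f ∧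
    Polynomial.X ^ k ∣ aeval (jet b v w) g

theorem hasJet_two {f g : MvPolynomial (Fin 3) K}
    (hnocsing : ∀ b : Fin 3 → K, b ≠ 0 →
      ¬((eval b f = 0 ∧ ∀ j, eval b (pderiv j f) = 0) ∧
        (eval b g = 0 ∧ ∀ j, eval b (pderiv j g) = 0))) {P : Fin 4 → K}
    (h : SingularAt (X 0 * rename Fin.succ f + rename Fin.succ g) P) (hb : P ∘ Fin.succ ≠ 0) :
    HasJet f g (P ∘ Fin.succ) 2 := by
  obtain ⟨v, hv, hvb⟩ := exists_tangent _ (P ∘ Fin.succ) (grad_ne hnocsing h hb)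
  obtain ⟨h0, h1, h2⟩ := sing_data h
  refine ⟨v, 0, hvb, jet_dvd2 h0 hv, jet_dvd2 h1 ?_⟩
  have : ∀ i, eval (P ∘ Fin.succ) (pderiv i g) = - (P 0 * eval (P ∘ Fin.succ) (pderiv i f)) :=
    fun i => by linear_combination h2 i
  simp only [Fin.sum_univ_three, this] at hv ⊢
  linear_combination (-P 0) * hv

theorem jet_bound {n : ℕ} {f g : MvPolynomial (Fin 3) K} (hf : f.IsHomogeneous (n + 1))
    (hg : g.IsHomogeneous (n + 2)) (hf0 : f ≠ 0)
    (hgcd : ∀ q : MvPolynomial (Fin 3) K, q ∣ f → q ∣ g → IsUnit q)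
    (hnocsing : ∀ b : Fin 3 → K, b ≠ 0 →
      ¬((eval b f = 0 ∧ ∀ j, eval b (pderiv j f) = 0) ∧
        (eval b g = 0 ∧ ∀ j, eval b (pderiv j g) = 0)))
    {ι : Type*} [Fintype ι] (P : ι → Fin 4 → K) (k : ι → ℕ)
    (hP : ∀ i, SingularAt (X 0 * rename Fin.succ f + rename Fin.succ g) (P i))
    (hb : ∀ i, P i ∘ Fin.succ ≠ 0) (hPP : ∀ i j, i ≠ j → ∀ c : K, P i ≠ c • P j)
    (hk : ∀ i, HasJet f g (P i ∘ Fin.succ) (k i)) :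
    ∑ i, k i ≤ (n + 1) * (n + 2) := by
  choose v w hv h1 h2 using hk
  exact bezout_jets hf hg hf0 hgcd (fun i => P i ∘ Fin.succ) v w k hb hv
    (fun i j hij c hc => hPP i j hij c
      (nonprop hf hg hnocsing (hP j) (hb j) (hP i) (hb i) c hc)) h1 h2

theorem card_bound {n : ℕ} {f g : MvPolynomial (Fin 3) K} (hf : f.IsHomogeneous (n + 1))
    (hg : g.IsHomogeneous (n + 2)) (hf0 : f ≠ 0)
    (hgcd : ∀ q : MvPolynomial (Fin 3) K, q ∣ f → q ∣ g → IsUnit q)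
    (hnocsing : ∀ b : Fin 3 → K, b ≠ 0 →
      ¬((eval b f = 0 ∧ ∀ j, eval b (pderiv j f) = 0) ∧
        (eval b g = 0 ∧ ∀ j, eval b (pderiv j g) = 0)))
    (S : Finset (Fin 4 → K))
    (hS : ∀ P ∈ S, SingularAt (X 0 * rename Fin.succ f + rename Fin.succ g) P ∧
        (P ∘ Fin.succ) ≠ 0)
    (hSS : ∀ P ∈ S, ∀ Q ∈ S, P ≠ Q → ∀ c : K, Q ≠ c • P) :
    2 * S.card ≤ (n + 1) * (n + 2) := by
  have := jet_bound hf hg hf0 hgcd hnocsing (fun i : S => (i : Fin 4 → K)) (fun _ => 2)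
    (fun i => (hS i i.2).1) (fun i => (hS i i.2).2)
    (fun i j hij c => hSS j j.2 i i.2 (fun h => hij (Subtype.ext h.symm)) c)
    (fun i => hasJet_two hnocsing (hS i i.2).1 (hS i i.2).2)
  simpa [mul_comm] using this

theorem no_jet_three {n : ℕ} {f g : MvPolynomial (Fin 3) K} (hf : f.IsHomogeneous (n + 1))
    (hg : g.IsHomogeneous (n + 2)) (hf0 : f ≠ 0)
    (hgcd : ∀ q : MvPolynomial (Fin 3) K, q ∣ f → q ∣ g → IsUnit q)
    (hnocsing : ∀ b : Fin 3 → K, b ≠ 0 →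
      ¬((eval b f = 0 ∧ ∀ j, eval b (pderiv j f) = 0) ∧
        (eval b g = 0 ∧ ∀ j, eval b (pderiv j g) = 0)))
    (S : Finset (Fin 4 → K))
    (hS : ∀ P ∈ S, SingularAt (X 0 * rename Fin.succ f + rename Fin.succ g) P ∧
        (P ∘ Fin.succ) ≠ 0)
    (hSS : ∀ P ∈ S, ∀ Q ∈ S, P ≠ Q → ∀ c : K, Q ≠ c • P)
    (hcard : 2 * S.card = (n + 1) * (n + 2)) {P : Fin 4 → K}
    (hP : SingularAt (X 0 * rename Fin.succ f + rename Fin.succ g) P) (hb : P ∘ Fin.succ ≠ 0) :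
    ¬ HasJet f g (P ∘ Fin.succ) 3 := by
  classical
  intro h3
  let T := S.filter (fun Q => ∀ c : K, Q ≠ c • P)
  have hT : ∀ Q ∈ T, Q ∈ S ∧ ∀ c : K, Q ≠ c • P := fun Q hQ => Finset.mem_filter.1 hQ
  have hTc : (S.filter (fun Q => ¬ ∀ c : K, Q ≠ c • P)).card ≤ 1 := by
    rw [Finset.card_le_one]
    intro A hA B hB
    obtain ⟨hA1, hA2⟩ := Finset.mem_filter.1 hA
    obtain ⟨hB1, hB2⟩ := Finset.mem_filter.1 hB
    push Not at hA2 hB2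
    obtain ⟨a, ha⟩ := hA2
    obtain ⟨b, hbb⟩ := hB2
    by_contra hAB
    have ha0 : a ≠ 0 := by
      rintro rfl
      apply (hS A hA1).2
      rw [ha]; funext i; simp
    apply hSS A hA1 B hB1 hAB (b * a⁻¹)
    rw [ha, hbb, smul_smul]
    congr 1
    field_simp
  have hsplit := Finset.card_filter_add_card_filter_not (s := S) (fun Q => ∀ c : K, Q ≠ c • P)
  have hTcard : S.card ≤ T.card + 1 := by
    rw [← hsplit]; exact Nat.add_le_add_left hTc _
  have := jet_bound hf hg hf0 hgcd hnocsing
    (fun i : Option T => i.elim P (fun Q => (Q : Fin 4 → K)))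
    (fun i => i.elim 3 (fun _ => 2)) ?_ ?_ ?_ ?_
  · rw [Fintype.sum_option] at this
    simp at this
    omega
  · rintro (_ | Q)
    · exact hP
    · exact (hS _ (hT Q Q.2).1).1
  · rintro (_ | Q)
    · exact hb
    · exact (hS _ (hT Q Q.2).1).2
  · rintro (_ | Q) (_ | R) hne c hc
    · exact hne rfl
    · simp only [Option.elim] at hc
      have hc0 : c ≠ 0 := by
        rintro rfl
        apply hb
        rw [hc]; funext i; simp
      apply (hT R R.2).2 c⁻¹
      rw [hc, smul_smul, inv_mul_cancel₀ hc0, one_smul]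
    · exact (hT Q Q.2).2 c hc
    · refine hSS R (hT R R.2).1 Q (hT Q Q.2).1 (fun h => hne ?_) c hc
      rw [Subtype.ext h]
  · rintro (_ | Q)
    · exact h3
    · exact hasJet_two hnocsing (hS _ (hT Q Q.2).1).1 (hS _ (hT Q Q.2).1).2

theorem euler_eval {σ : Type*} [Fintype σ] {n : ℕ} {p : MvPolynomial σ K} (hp : p.IsHomogeneous n)
    (b : σ → K) : ∑ j, b j * eval b (pderiv j p) = n * eval b p := by
  have := congrArg (eval b) hp.sum_X_mul_pderiv
  simpa using this

theorem ker_data [CharZero K] {n : ℕ} {f g : MvPolynomial (Fin 3) K} (hf : f.IsHomogeneous (n + 1))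
    (hg : g.IsHomogeneous (n + 2))
    (hnocsing : ∀ b : Fin 3 → K, b ≠ 0 →
      ¬((eval b f = 0 ∧ ∀ j, eval b (pderiv j f) = 0) ∧
        (eval b g = 0 ∧ ∀ j, eval b (pderiv j g) = 0))) {P : Fin 4 → K}
    (hP : SingularAt (X 0 * rename Fin.succ f + rename Fin.succ g) P) (hb : P ∘ Fin.succ ≠ 0)
    (h3 : ¬ HasJet f g (P ∘ Fin.succ) 3) (s : K) (u : Fin 3 → K)
    (hu : ∑ j, eval (P ∘ Fin.succ) (pderiv j f) * u j = 0)
    (hs : ∀ i, s * eval (P ∘ Fin.succ) (pderiv i f) +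
      ∑ j, (P 0 * eval (P ∘ Fin.succ) (pderiv j (pderiv i f)) +
        eval (P ∘ Fin.succ) (pderiv j (pderiv i g))) * u j = 0) :
    ∃ c : K, s = c * P 0 ∧ u = c • (P ∘ Fin.succ) := by
  obtain ⟨k, hk⟩ := grad_ne hnocsing hP hb
  obtain ⟨h0, h1, h2⟩ := sing_data hP
  have hgi : ∀ i, eval (P ∘ Fin.succ) (pderiv i g) = - (P 0 * eval (P ∘ Fin.succ) (pderiv i f)) :=
    fun i => by linear_combination h2 i
  have key : ∃ c : K, u = c • (P ∘ Fin.succ) := by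
    by_contra hcon
    push Not at hcon
    obtain ⟨w, hw⟩ : ∃ w : Fin 3 → K, 2 * ∑ i, w i * eval (P ∘ Fin.succ) (pderiv i f) +
        ∑ i, u i * ∑ j, u j * eval (P ∘ Fin.succ) (pderiv j (pderiv i f)) = 0 := by
      refine ⟨Pi.single k (-(∑ i, u i * ∑ j, u j *
        eval (P ∘ Fin.succ) (pderiv j (pderiv i f))) / 2 /
        eval (P ∘ Fin.succ) (pderiv k f)), ?_⟩
      rw [Finset.sum_eq_single k]
      · rw [Pi.single_eq_same]
        field_simp
        ring
      · intro b _ hbk; simp [hbk]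
      · simp
    have huf : ∑ i, u i * eval (P ∘ Fin.succ) (pderiv i f) = 0 := by
      rw [← hu]; exact Finset.sum_congr rfl fun i _ => mul_comm _ _
    refine h3 ⟨u, w, hcon, jet_dvd3 h0 huf hw, jet_dvd3 h1 ?_ ?_⟩
    · simp only [Fin.sum_univ_three, hgi] at huf ⊢
      linear_combination (-P 0) * huf
    · have e0 := hs 0
      have e1 := hs 1
      have e2 := hs 2
      simp only [Fin.sum_univ_three, hgi] at huf hw e0 e1 e2 ⊢
      linear_combination (-P 0) * hw + u 0 * e0 + u 1 * e1 + u 2 * e2 - s * huf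
  obtain ⟨c, hc⟩ := key
  refine ⟨c, ?_, hc⟩
  have e1 := euler_eval (n := n) (p := pderiv k f) (by simpa using hf.pderiv (i := k))
    (P ∘ Fin.succ)
  have e2 := euler_eval (n := n + 1) (p := pderiv k g) (by simpa using hg.pderiv (i := k))
    (P ∘ Fin.succ)
  have e3 := hs k
  rw [hgi] at e2
  subst hc
  have : eval (P ∘ Fin.succ) (pderiv k f) * (s - c * P 0) = 0 := by
    push_cast at e2
    simp only [Fin.sum_univ_three, Pi.smul_apply, smul_eq_mul] at e1 e2 e3
    linear_combination e3 - c * P 0 * e1 - c * e2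
  rcases mul_eq_zero.1 this with h | h
  · exact absurd h hk
  · exact sub_eq_zero.1 h

theorem ker_F [CharZero K] {n : ℕ} {f g : MvPolynomial (Fin 3) K} (hf : f.IsHomogeneous (n + 1))
    (hg : g.IsHomogeneous (n + 2))
    (hnocsing : ∀ b : Fin 3 → K, b ≠ 0 →
      ¬((eval b f = 0 ∧ ∀ j, eval b (pderiv j f) = 0) ∧
        (eval b g = 0 ∧ ∀ j, eval b (pderiv j g) = 0))) {P : Fin 4 → K}
    (hP : SingularAt (X 0 * rename Fin.succ f + rename Fin.succ g) P) (hb : P ∘ Fin.succ ≠ 0)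
    (h3 : ¬ HasJet f g (P ∘ Fin.succ) 3) (U : Fin 4 → K)
    (hU : ∀ i, ∑ j, eval P (pderiv j (pderiv i
      (X 0 * rename Fin.succ f + rename Fin.succ g))) * U j = 0) :
    ∃ c : K, U = c • P := by
  obtain ⟨c, h1, h2⟩ := ker_data hf hg hnocsing hP hb h3 (U 0) (U ∘ Fin.succ) (by
      have := hU 0
      rw [Fin.sum_univ_succ] at this
      simp only [pderiv_zero_F, pderiv_zero_rename, pderiv_succ_rename, eval_rename] at this
      simpa using this) (by
      intro i
      have := hU i.succ
      rw [Fin.sum_univ_succ] at this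
      simp only [pderiv_succ_F] at this
      erw [pderiv_zero_F] at this
      simp only [eval_rename, map_add, map_mul, eval_X] at this
      rw [mul_comm]
      exact this)
  refine ⟨c, ?_⟩
  funext i
  refine Fin.cases ?_ (fun k => ?_) i
  · simpa using h1
  · simpa using congrFun h2 k

theorem localEq_chart (P : Fin 4 → K) (r : Fin 4) :
    ∃ γ : Fin 4 → MvPolynomial (Fin 3) K, (∀ F, localEq F P r = aeval γ F) ∧ γ r = 1 ∧
      ∀ j, γ (r.succAbove j) = C (P (r.succAbove j) / P r) + X j :=
  ⟨_, fun _ => rfl, Fin.insertNth_apply_same (α := fun _ => MvPolynomial (Fin 3) K) r _ _,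
    Fin.insertNth_apply_succAbove (α := fun _ => MvPolynomial (Fin 3) K) r _ _⟩

theorem pderiv_localEq (F : MvPolynomial (Fin 4) K) (P : Fin 4 → K) (r : Fin 4) (j : Fin 3) :
    pderiv j (localEq F P r) = localEq (pderiv (r.succAbove j) F) P r := by
  obtain ⟨γ, h1, h2, h3⟩ := localEq_chart P r
  rw [h1, h1]
  induction F using MvPolynomial.induction_on with
  | C a => simp
  | add p q hp hq => rw [map_add, map_add, map_add, map_add, hp, hq]
  | mul_X p k hp =>
    rw [map_mul, Derivation.leibniz, hp, aeval_X, Derivation.leibniz, map_add, smul_eq_mul,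
      smul_eq_mul, smul_eq_mul, smul_eq_mul, map_mul, map_mul, aeval_X]
    congr 2
    refine r.succAboveCases ?_ (fun i => ?_) k
    · rw [h2]
      simp [pderiv_X]
    · rw [h3]
      by_cases h : i = j
      · subst h; simp [pderiv_X]
      · simp [pderiv_X, Pi.single_apply, h]

theorem eval_localEq (F : MvPolynomial (Fin 4) K) (P : Fin 4 → K) (r : Fin 4) (hr : P r = 1) :
    eval 0 (localEq F P r) = eval P F := by
  obtain ⟨γ, h1, h2, h3⟩ := localEq_chart P r
  rw [h1, ← MvPolynomial.coe_aeval_eq_eval, ← MvPolynomial.coe_aeval_eq_eval]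
  change aeval (0 : Fin 3 → K) (aeval _ F) = aeval P F
  rw [← AlgHom.comp_apply, MvPolynomial.comp_aeval]
  congr 2
  funext k
  refine r.succAboveCases ?_ (fun i => ?_) k
  · rw [h2]
    simp [hr]
  · rw [h3]
    simp [hr]

theorem localEq_smul (F : MvPolynomial (Fin 4) K) (P : Fin 4 → K) (r : Fin 4) (c : K)
    (hc : c ≠ 0) : localEq F (c • P) r = localEq F P r := by
  unfold localEq
  have : ∀ j, (c • P) (r.succAbove j) / (c • P) r = P (r.succAbove j) / P r := by
    intro j
    simp only [Pi.smul_apply, smul_eq_mul]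
    rw [mul_div_mul_left _ _ hc]
  simp only [this]

theorem node_of_ker [IsAlgClosed K] [CharZero K] {D : ℕ} (F : MvPolynomial (Fin 4) K)
    (hF : F.IsHomogeneous D) (P : Fin 4 → K) (r : Fin 4) (hr : P r = 1) (hP : SingularAt F P)
    (hker : ∀ U : Fin 4 → K, (∀ i, ∑ j, eval P (pderiv j (pderiv i F)) * U j = 0) →
      ∃ c : K, U = c • P) : IsATypeSing (localEq F P r) 1 := by
  refine nondeg_isA1 _ ?_ ?_ ?_
  · rw [eval_localEq _ _ _ hr, hP.1]
  · intro i
    rw [pderiv_localEq, eval_localEq _ _ _ hr, hP.2]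
  · intro u hu
    simp only [pderiv_localEq, eval_localEq _ _ _ hr] at hu
    let U : Fin 4 → K := r.insertNth (α := fun _ => K) 0 u
    have hUr : U r = 0 := Fin.insertNth_apply_same (α := fun _ => K) r _ _
    have hUs : ∀ i, U (r.succAbove i) = u i := fun i =>
      Fin.insertNth_apply_succAbove (α := fun _ => K) r _ _ i
    have hrow : ∀ i, ∑ j, eval P (pderiv j (pderiv (r.succAbove i) F)) * U j = 0 := by
      intro i
      rw [Fin.sum_univ_succAbove _ r, hUr]
      simp only [hUs, hu, mul_zero, zero_add]
    have htot : ∑ i, P i * ∑ j, eval P (pderiv j (pderiv i F)) * U j = 0 := by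
      have : ∀ j, ∑ i, P i * eval P (pderiv j (pderiv i F)) = 0 := by
        intro j
        have := euler_eval (hF.pderiv (i := j)) P
        rw [hP.2, mul_zero] at this
        rw [← this]
        exact Finset.sum_congr rfl fun i _ => by rw [pderiv_comm']
      simp only [Finset.mul_sum]
      rw [Finset.sum_comm]
      refine Finset.sum_eq_zero fun j _ => ?_
      simp only [← mul_assoc]
      rw [← Finset.sum_mul, this, zero_mul]
    rw [Fin.sum_univ_succAbove _ r] at htot
    simp only [hrow, hr, mul_zero, Finset.sum_const_zero, add_zero, one_mul] at htot
    obtain ⟨c, hc⟩ := hker U (fun i => by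
      refine r.succAboveCases ?_ (fun i => ?_) i
      · exact htot
      · exact hrow i)
    have hc0 : c = 0 := by
      have := congrFun hc r
      rw [hUr] at this
      simpa [hr] using this.symm
    funext i
    rw [← hUs, hc, hc0]
    simp

theorem singularAt_smul {D : ℕ} {F : MvPolynomial (Fin 4) K} (hF : F.IsHomogeneous D)
    {P : Fin 4 → K} (hP : SingularAt F P) (c : K) : SingularAt F (c • P) := by
  refine ⟨?_, fun i => ?_⟩
  · rw [eval_smul_hom hF, hP.1, mul_zero]
  · rw [eval_smul_hom hF.pderiv, hP.2, mul_zero]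

/-- a normalized non-degenerate monoid surface of degree `d` has at most
`d(d-1)/2` singular points besides `O = (1:0:0:0)` (any set of pairwise non-proportional
singular representatives besides `O` has cardinality at most `d(d-1)/2`); and if this maximum
is attained, every singular point other than `O` is an ordinary node (type `A₁`). -/
theorem stmt9 [CharZero K] [IsAlgClosed K] {d : ℕ} (hd : 3 ≤ d)
    (f g : MvPolynomial (Fin 3) K)
    (hf : f.IsHomogeneous (d - 1)) (hg : g.IsHomogeneous d) (hf0 : f ≠ 0) (hg0 : g ≠ 0)
    (hgcd : ∀ q : MvPolynomial (Fin 3) K, q ∣ f → q ∣ g → IsUnit q)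
    (hnocsing : ∀ b : Fin 3 → K, b ≠ 0 →
      ¬((eval b f = 0 ∧ ∀ j, eval b (pderiv j f) = 0) ∧
        (eval b g = 0 ∧ ∀ j, eval b (pderiv j g) = 0))) :
    (∀ S : Finset (Fin 4 → K),
      (∀ P ∈ S, SingularAt (X 0 * rename Fin.succ f + rename Fin.succ g) P ∧
        (P ∘ Fin.succ) ≠ 0) →
      (∀ P ∈ S, ∀ Q ∈ S, P ≠ Q → ∀ c : K, Q ≠ c • P) →
      S.card ≤ d * (d - 1) / 2) ∧
    ((∃ S : Finset (Fin 4 → K),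
      (∀ P ∈ S, SingularAt (X 0 * rename Fin.succ f + rename Fin.succ g) P ∧
        (P ∘ Fin.succ) ≠ 0) ∧
      (∀ P ∈ S, ∀ Q ∈ S, P ≠ Q → ∀ c : K, Q ≠ c • P) ∧
      S.card = d * (d - 1) / 2) →
      ∀ P : Fin 4 → K, SingularAt (X 0 * rename Fin.succ f + rename Fin.succ g) P →
        (P ∘ Fin.succ) ≠ 0 → ∀ r : Fin 4, P r ≠ 0 →
          IsATypeSing (localEq (X 0 * rename Fin.succ f + rename Fin.succ g) P r) 1) := by
  obtain ⟨n, rfl⟩ : ∃ n, d = n + 2 := ⟨d - 2, by omega⟩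
  have hf' : f.IsHomogeneous (n + 1) := by simpa using hf
  have e : (n + 2) * (n + 2 - 1) = (n + 1) * (n + 2) := by
    rw [mul_comm]; rfl
  have heven : 2 * ((n + 1) * (n + 2) / 2) = (n + 1) * (n + 2) :=
    Nat.mul_div_cancel' (Nat.even_mul_succ_self (n + 1)).two_dvd
  rw [e]
  refine ⟨fun S hS hSS => ?_, ?_⟩
  · have := card_bound hf' hg hf0 hgcd hnocsing S hS hSS
    omega
  · rintro ⟨S, hS, hSS, hcard⟩ P hP hb r hr
    have hF : (X 0 * rename Fin.succ f + rename Fin.succ g :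
        MvPolynomial (Fin 4) K).IsHomogeneous (n + 2) := by
      refine IsHomogeneous.add ?_ hg.rename_isHomogeneous
      have := (isHomogeneous_X K (0 : Fin 4)).mul (hf'.rename_isHomogeneous (f := Fin.succ))
      rwa [show 1 + (n + 1) = n + 2 by omega] at this
    have hc : (P r)⁻¹ ≠ 0 := inv_ne_zero hr
    rw [← localEq_smul _ P r _ hc]
    have hP' := singularAt_smul hF hP (P r)⁻¹
    have hb' : ((P r)⁻¹ • P) ∘ Fin.succ ≠ 0 := by
      intro h
      apply hb
      funext i
      have := congrFun h i
      simpa [hr] using this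
    refine node_of_ker _ hF _ r (by simp [hr]) hP' ?_
    exact ker_F hf' hg hnocsing hP' hb'
      (no_jet_three hf' hg hf0 hgcd hnocsing S hS hSS (by omega) hP' hb')
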